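/- For every real number q with 0 < q < 1, the following identity between minimal model characters of central charges 4/5 and −22/5 holds: χ_{5,6}^{2,1}(q) − χ_{5,6}^{2,5}(q) = χ_{2,5}^{1,1}(q^{2}). -/

import Mathlib

open scoped BigOperators

/-- The Euler product `(q)_∞ = ∏_{i=1}^∞ (1 - q^i)`. -/
noncomputable def eulerProd (q : ℝ) : ℝ := ∏' i : ℕ, (1 - q ^ (i + 1))

/-- The Virasoro minimal model character `χ_{s,t}^{m,n}(q)`:
`q^(h - c/24) · (q)_∞⁻¹ · Σ_{k∈ℤ} q^(s t k²) (q^(k(mt-ns)) - q^((mt+ns)k+mn))`,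
where `c = 1 - 6(s-t)²/(st)` and `h = ((mt-ns)² - (s-t)²)/(4st)`. -/
noncomputable def minChar (s t m n : ℤ) (q : ℝ) : ℝ :=
  q ^ ((((((m * t - n * s) ^ 2 - (s - t) ^ 2 : ℤ) : ℝ)) / (4 * (s : ℝ) * (t : ℝ))) -
        (1 - 6 * ((s : ℝ) - (t : ℝ)) ^ 2 / ((s : ℝ) * (t : ℝ))) / 24) *
    (eulerProd q)⁻¹ *
    ∑' k : ℤ, ((q ^ (s * t * k ^ 2 + k * (m * t - n * s)) : ℝ) -
               (q ^ (s * t * k ^ 2 + (m * t + n * s) * k + m * n) : ℝ))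

namespace QSeries

open Filter Topology

/-- The binomial coefficient `n.choose 2` extended to all integers. -/
def tri (n : ℤ) : ℤ := n * (n - 1) / 2

lemma two_mul_tri (n : ℤ) : 2 * tri n = n * (n - 1) :=
  Int.mul_ediv_cancel' (Int.even_mul_pred_self n).two_dvd

lemma tri_add_one (n : ℤ) : tri (n + 1) = tri n + n := by
  linarith [two_mul_tri n, two_mul_tri (n + 1)]

lemma tri_neg (n : ℤ) : tri (-n) = tri n + n := by
  linarith [two_mul_tri n, two_mul_tri (-n)]

lemma tri_one_sub (n : ℤ) : tri (1 - n) = tri n := by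
  linarith [two_mul_tri n, two_mul_tri (1 - n)]

section Summability

variable {q w : ℝ}

lemma summable_nat_theta (hq0 : 0 < q) (hq1 : q < 1) (hw : w ≠ 0) :
    Summable fun n : ℕ => q ^ tri n * w ^ n := by
  refine summable_of_ratio_test_tendsto_lt_one zero_lt_one (.of_forall fun n => ?_) ?_
  · positivity
  · have h : Tendsto (fun n : ℕ => q ^ n * ‖w‖) atTop (𝓝 (0 * ‖w‖)) :=
      (tendsto_pow_atTop_nhds_zero_of_lt_one hq0.le hq1).mul_const _
    rw [zero_mul] at h
    refine h.congr fun n => ?_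
    have h1 : q ^ tri n ≠ 0 := by positivity
    have h2 : ‖w‖ ≠ 0 := by positivity
    rw [Nat.cast_succ, tri_add_one, zpow_add₀ hq0.ne', zpow_natCast, pow_succ, norm_mul, norm_mul,
      norm_mul, norm_mul, norm_pow, norm_pow, Real.norm_of_nonneg hq0.le]
    have h3 : ‖q ^ tri n‖ ≠ 0 := by positivity
    field_simp

lemma summable_theta (hq0 : 0 < q) (hq1 : q < 1) (hw : w ≠ 0) :
    Summable fun n : ℤ => q ^ tri n * w ^ n := by
  refine .of_nat_of_neg ?_ ?_
  · simpa using summable_nat_theta hq0 hq1 hw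
  · refine (summable_nat_theta hq0 hq1 (div_ne_zero hq0.ne' hw)).congr fun n => ?_
    rw [tri_neg, zpow_add₀ hq0.ne', zpow_neg, div_pow, zpow_natCast, zpow_natCast]
    field_simp

end Summability

section FiniteTripleProduct

/-- The finite product `(1 - q) ⋯ (1 - q ^ n)`. -/
noncomputable def qFac (q : ℝ) (n : ℕ) : ℝ := ∏ i ∈ Finset.range n, (1 - q ^ (i + 1))

/-- The reciprocal of `qFac`, extended by zero to negative integers. -/
noncomputable def qFacInv (q : ℝ) : ℤ → ℝ
  | .ofNat n => (qFac q n)⁻¹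
  | .negSucc _ => 0

variable {q : ℝ}

lemma one_sub_pow_pos (hq0 : 0 < q) (hq1 : q < 1) (i : ℕ) : 0 < 1 - q ^ (i + 1) :=
  sub_pos.2 (pow_lt_one₀ hq0.le hq1 i.succ_ne_zero)

lemma qFac_pos (hq0 : 0 < q) (hq1 : q < 1) (n : ℕ) : 0 < qFac q n :=
  Finset.prod_pos fun i _ => one_sub_pow_pos hq0 hq1 i

lemma qFac_succ (n : ℕ) : qFac q (n + 1) = qFac q n * (1 - q ^ (n + 1)) :=
  Finset.prod_range_succ _ _

lemma qFac_antitone (hq0 : 0 < q) (hq1 : q < 1) : Antitone (qFac q) := by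
  refine antitone_nat_of_succ_le fun n => ?_
  rw [qFac_succ]
  exact mul_le_of_le_one_right (qFac_pos hq0 hq1 n).le (by linarith [pow_pos hq0 (n + 1)])

lemma qFacInv_sub_one (hq0 : 0 < q) (hq1 : q < 1) (n : ℤ) :
    qFacInv q (n - 1) = qFacInv q n * (1 - q ^ n) := by
  rcases n with n | n
  · rcases n with _ | n
    · simp [qFacInv]
      rfl
    · have h : (Int.ofNat (n + 1)) - 1 = Int.ofNat n := by simp
      have h1 := (one_sub_pow_pos hq0 hq1 n).ne'
      have h2 := (qFac_pos hq0 hq1 n).ne'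
      rw [h]
      simp only [qFacInv, qFac_succ, Int.ofNat_eq_natCast, zpow_natCast]
      field_simp
  · have h : Int.negSucc n - 1 = Int.negSucc (n + 1) := by grind
    simp [h, qFacInv]

/-- The coefficients of the finite Jacobi triple product. -/
noncomputable def tripleCoeff (q : ℝ) (N : ℕ) (n : ℤ) : ℝ :=
  qFac q (2 * N) * qFacInv q (N + n) * qFacInv q (N - n)

lemma tripleCoeff_succ (hq0 : 0 < q) (hq1 : q < 1) (N : ℕ) (n : ℤ) :
    tripleCoeff q (N + 1) n = (1 + q ^ (2 * N + 1)) * tripleCoeff q N n +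
      q ^ (N + 1 - n : ℤ) * tripleCoeff q N (n - 1) +
      q ^ (N + 1 + n : ℤ) * tripleCoeff q N (n + 1) := by
  have hq := hq0.ne'
  have e1 := qFacInv_sub_one hq0 hq1 (N + 1 + n)
  have e2 := qFacInv_sub_one hq0 hq1 (N + n)
  have e3 := qFacInv_sub_one hq0 hq1 (N + 1 - n)
  have e4 := qFacInv_sub_one hq0 hq1 (N - n)
  have f1 : (N : ℤ) + 1 + n - 1 = N + n := by ring
  have f2 : (N : ℤ) + 1 - n - 1 = N - n := by ring
  have f3 : (N : ℤ) + (n - 1) = N + n - 1 := by ring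
  have f4 : (N : ℤ) - (n - 1) = N + 1 - n := by ring
  have f5 : (N : ℤ) + (n + 1) = N + 1 + n := by ring
  have f6 : (N : ℤ) - (n + 1) = N - n - 1 := by ring
  have g1 : q ^ (N + 1 + n : ℤ) = q * q ^ (N + n : ℤ) := by
    rw [← zpow_one_add₀ hq]; congr 1; ring
  have g2 : q ^ (N + 1 - n : ℤ) = q * q ^ (N - n : ℤ) := by
    rw [← zpow_one_add₀ hq]; congr 1; ring
  have g3 : q ^ (2 * N) = q ^ (N + n : ℤ) * q ^ (N - n : ℤ) := by
    rw [← zpow_add₀ hq, ← zpow_natCast]; congr 1; push_cast; ring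
  have g4 : 2 * (N + 1) = 2 * N + 1 + 1 := by ring
  simp only [tripleCoeff, Nat.cast_succ, f3, f4, f5, f6, g4, qFac_succ]
  rw [f1] at e1
  rw [f2] at e3
  rw [e2, e4, e1, e3, g1, g2]
  simp only [pow_succ, g3]
  ring

lemma hasSum_finite_triple {w : ℝ} (hq0 : 0 < q) (hq1 : q < 1) (hw : w ≠ 0) (N : ℕ) :
    HasSum (fun n : ℤ => tripleCoeff q N n * (q ^ tri n * w ^ n))
      (∏ i ∈ Finset.range N, ((1 + w * q ^ i) * (1 + q ^ (i + 1) / w))) := by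
  have hq := hq0.ne'
  induction N with
  | zero =>
    convert hasSum_single (0 : ℤ) fun n hn => ?_ using 1
    · simp [tripleCoeff, qFacInv, qFac, tri]
    · rcases n with n | n
      · rcases n with _ | n
        · simp at hn
        · have h : (0 : ℤ) - Int.ofNat (n + 1) = Int.negSucc n := by grind
          simp only [tripleCoeff, Nat.cast_zero, h]
          simp [qFacInv]
      · simp [tripleCoeff, qFacInv]
  | succ N ih =>
    rw [Finset.prod_range_succ]
    generalize ∏ i ∈ Finset.range N, ((1 + w * q ^ i) * (1 + q ^ (i + 1) / w)) = P at ih ⊢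
    have h1 := ((Equiv.subRight (1 : ℤ)).hasSum_iff.2 ih).mul_left (q ^ N * w)
    have h2 := ((Equiv.addRight (1 : ℤ)).hasSum_iff.2 ih).mul_left (q ^ (N + 1) / w)
    have hP : P * ((1 + w * q ^ N) * (1 + q ^ (N + 1) / w)) =
        (1 + q ^ (2 * N + 1)) * P + q ^ N * w * P + q ^ (N + 1) / w * P := by
      field_simp
      ring
    rw [hP]
    refine (congrArg (HasSum · _) (funext fun n => ?_)).mpr
      (((ih.mul_left (1 + q ^ (2 * N + 1))).add h1).add h2)
    have t1 : tri (n - 1) = tri n - n + 1 := by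
      linarith [two_mul_tri n, two_mul_tri (n - 1)]
    simp only [Function.comp, Equiv.subRight_apply, Equiv.coe_addRight,
      tripleCoeff_succ hq0 hq1, tri_add_one, t1, zpow_add₀ hq, zpow_sub₀ hq, zpow_add₀ hw,
      zpow_sub₀ hw, zpow_natCast, zpow_one, pow_succ]
    field_simp

end FiniteTripleProduct
section TripleProduct

variable {q : ℝ}

/-- The infinite product `∏_{i ≥ 0} (1 - q ^ (d i + a))`. -/
noncomputable def qProd (q : ℝ) (a d : ℕ) : ℝ := ∏' i : ℕ, (1 - q ^ (d * i + a))

lemma multipliable_one_add_mul_pow (hq0 : 0 < q) (hq1 : q < 1) (w : ℝ) :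
    Multipliable fun i : ℕ => 1 + w * q ^ i :=
  Real.multipliable_one_add_of_summable ((summable_geometric_of_lt_one hq0.le hq1).mul_left w)

lemma multipliable_one_sub_pow (hq0 : 0 < q) (hq1 : q < 1) (a : ℕ) {d : ℕ} (hd : d ≠ 0) :
    Multipliable fun i : ℕ => 1 - q ^ (d * i + a) := by
  refine (multipliable_one_add_mul_pow (pow_pos hq0 d) (pow_lt_one₀ hq0.le hq1 hd)
    (-q ^ a)).congr fun i => ?_
  ring

lemma qProd_ne_zero (hq0 : 0 < q) (hq1 : q < 1) {a d : ℕ} (ha : a ≠ 0) (hd : d ≠ 0) :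
    qProd q a d ≠ 0 := by
  have hs : Summable fun i : ℕ => q ^ (d * i + a) := by
    refine ((summable_geometric_of_lt_one (pow_pos hq0 d).le
      (pow_lt_one₀ hq0.le hq1 hd)).mul_left (q ^ a)).congr fun i => ?_
    ring
  refine tprod_one_add_ne_zero_of_summable (f := fun i => -q ^ (d * i + a)) (fun i => ?_) ?_
  · have := pow_lt_one₀ hq0.le hq1 (n := d * i + a) (by lia)
    linarith
  · simpa using hs.abs

lemma tendsto_qFac (hq0 : 0 < q) (hq1 : q < 1) :
    Tendsto (qFac q) atTop (𝓝 (qProd q 1 1)) := by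
  have h := (multipliable_one_sub_pow hq0 hq1 1 one_ne_zero).tendsto_prod_tprod_nat
  unfold qProd
  simp only [one_mul] at h ⊢
  exact h

lemma qProd_le_qFac (hq0 : 0 < q) (hq1 : q < 1) (n : ℕ) : qProd q 1 1 ≤ qFac q n :=
  (qFac_antitone hq0 hq1).le_of_tendsto (tendsto_qFac hq0 hq1) n

lemma qProd_one_one_pos (hq0 : 0 < q) (hq1 : q < 1) : 0 < qProd q 1 1 :=
  (ge_of_tendsto' (tendsto_qFac hq0 hq1) fun n => (qFac_pos hq0 hq1 n).le).lt_of_ne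
    (qProd_ne_zero hq0 hq1 one_ne_zero one_ne_zero).symm

lemma qFacInv_nonneg (hq0 : 0 < q) (hq1 : q < 1) (n : ℤ) : 0 ≤ qFacInv q n := by
  rcases n with n | n
  · exact (inv_pos.2 (qFac_pos hq0 hq1 n)).le
  · exact le_rfl

lemma qFacInv_le (hq0 : 0 < q) (hq1 : q < 1) (n : ℤ) : qFacInv q n ≤ (qProd q 1 1)⁻¹ := by
  have h := qProd_one_one_pos hq0 hq1
  rcases n with n | n
  · exact inv_anti₀ h (qProd_le_qFac hq0 hq1 n)
  · exact (inv_pos.2 h).le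

lemma tendsto_qFacInv (hq0 : 0 < q) (hq1 : q < 1) :
    Tendsto (qFacInv q) atTop (𝓝 (qProd q 1 1)⁻¹) := by
  refine Tendsto.congr' (f₁ := fun n : ℤ => (qFac q n.toNat)⁻¹) ?_ ?_
  · filter_upwards [eventually_ge_atTop 0] with n hn
    lift n to ℕ using hn
    rfl
  · refine ((tendsto_qFac hq0 hq1).inv₀ (qProd_one_one_pos hq0 hq1).ne').comp ?_
    refine tendsto_atTop.2 fun b => ?_
    filter_upwards [eventually_ge_atTop (b : ℤ)] with n hn
    lia

lemma tripleCoeff_nonneg (hq0 : 0 < q) (hq1 : q < 1) (N : ℕ) (n : ℤ) : 0 ≤ tripleCoeff q N n :=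
  mul_nonneg (mul_nonneg (qFac_pos hq0 hq1 _).le (qFacInv_nonneg hq0 hq1 _))
    (qFacInv_nonneg hq0 hq1 _)

lemma tripleCoeff_le (hq0 : 0 < q) (hq1 : q < 1) (N : ℕ) (n : ℤ) :
    tripleCoeff q N n ≤ (qProd q 1 1)⁻¹ * (qProd q 1 1)⁻¹ := by
  have h1 : qFac q (2 * N) ≤ 1 := by
    simpa [qFac] using qFac_antitone hq0 hq1 (Nat.zero_le (2 * N))
  have h2 := (qFac_pos hq0 hq1 (2 * N)).le
  have h3 := qFacInv_nonneg hq0 hq1 (N + n)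
  have h4 := qFacInv_nonneg hq0 hq1 (N - n)
  unfold tripleCoeff
  gcongr
  · exact (inv_pos.2 (qProd_one_one_pos hq0 hq1)).le
  · exact (mul_le_of_le_one_left h3 h1).trans (qFacInv_le hq0 hq1 _)
  · exact qFacInv_le hq0 hq1 _

lemma tendsto_tripleCoeff (hq0 : 0 < q) (hq1 : q < 1) (n : ℤ) :
    Tendsto (fun N => tripleCoeff q N n) atTop (𝓝 (qProd q 1 1)⁻¹) := by
  have hc : Tendsto (fun N : ℕ => (N : ℤ)) atTop atTop := tendsto_natCast_atTop_atTop
  have h1 : Tendsto (fun N : ℕ => 2 * N) atTop atTop :=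
    tendsto_id.const_mul_atTop' two_pos
  have h := (((tendsto_qFac hq0 hq1).comp h1).mul
    ((tendsto_qFacInv hq0 hq1).comp (tendsto_atTop_add_const_right _ n hc))).mul
    ((tendsto_qFacInv hq0 hq1).comp (tendsto_atTop_add_const_right _ (-n) hc))
  rw [mul_inv_cancel₀ (qProd_one_one_pos hq0 hq1).ne', one_mul] at h
  exact h

/-- The **Jacobi triple product** identity. -/
theorem hasSum_triple_product {w : ℝ} (hq0 : 0 < q) (hq1 : q < 1) (hw : w ≠ 0) :
    HasSum (fun n : ℤ => q ^ tri n * w ^ n)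
      (qProd q 1 1 * (∏' i : ℕ, (1 + w * q ^ i)) * ∏' i : ℕ, (1 + q ^ (i + 1) / w)) := by
  have hP := qProd_one_one_pos hq0 hq1
  have hs := summable_theta hq0 hq1 hw
  have hlim : Tendsto (fun N => ∑' n : ℤ, tripleCoeff q N n * (q ^ tri n * w ^ n)) atTop
      (𝓝 (∑' n : ℤ, (qProd q 1 1)⁻¹ * (q ^ tri n * w ^ n))) := by
    refine tendsto_tsum_of_dominated_convergence
      (bound := fun n => (qProd q 1 1)⁻¹ * (qProd q 1 1)⁻¹ * ‖q ^ tri n * w ^ n‖)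
      (hs.norm.mul_left _) (fun n => (tendsto_tripleCoeff hq0 hq1 n).mul_const _)
      (.of_forall fun N n => ?_)
    rw [norm_mul, Real.norm_of_nonneg (tripleCoeff_nonneg hq0 hq1 N n)]
    gcongr
    exact tripleCoeff_le hq0 hq1 N n
  have hm : Multipliable fun i : ℕ => 1 + q ^ (i + 1) / w :=
    (multipliable_one_add_mul_pow hq0 hq1 (q / w)).congr fun i => by ring
  have hprod := (multipliable_one_add_mul_pow hq0 hq1 w).tendsto_prod_tprod_nat.mul
    hm.tendsto_prod_tprod_nat
  simp only [← Finset.prod_mul_distrib, ← (hasSum_finite_triple hq0 hq1 hw _).tsum_eq] at hprod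
  have he := tendsto_nhds_unique hlim hprod
  rw [tsum_mul_left, inv_mul_eq_iff_eq_mul₀ hP.ne'] at he
  rw [mul_assoc, ← he]
  exact hs.hasSum

/-- The Jacobi triple product for alternating sums of powers of `q`. -/
theorem hasSum_theta (hq0 : 0 < q) (hq1 : q < 1) (a b : ℕ) (h : a + b ≠ 0) :
    HasSum (fun n : ℤ => (-1) ^ n * q ^ ((a + b : ℕ) * tri n + a * n))
      (qProd q (a + b) (a + b) * qProd q a (a + b) * qProd q b (a + b)) := by
  have hq := hq0.ne'
  have key := hasSum_triple_product (pow_pos hq0 (a + b)) (pow_lt_one₀ hq0.le hq1 h)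
    (neg_ne_zero.2 (pow_pos hq0 a).ne')
  have e1 : qProd (q ^ (a + b)) 1 1 = qProd q (a + b) (a + b) := by
    unfold qProd
    congr! 2 with i
    rw [← pow_mul]
    ring
  have e2 : ∏' i : ℕ, (1 + -q ^ a * (q ^ (a + b)) ^ i) = qProd q a (a + b) := by
    unfold qProd
    congr! 2 with i
    rw [← pow_mul]
    ring
  have e3 : ∏' i : ℕ, (1 + (q ^ (a + b)) ^ (i + 1) / -q ^ a) = qProd q b (a + b) := by
    unfold qProd
    congr! 2 with i
    rw [← pow_mul]
    field_simp
    ring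
  rw [e1, e2, e3] at key
  refine (congrArg (HasSum · _) (funext fun n => ?_)).mpr key
  rw [neg_eq_neg_one_mul (q ^ a), mul_zpow, ← zpow_natCast q (a + b),
    ← zpow_natCast q a, ← zpow_mul,
    ← zpow_mul, zpow_add₀ hq]
  ring

lemma summable_zpow_tri (hq0 : 0 < q) (hq1 : q < 1) {c : ℕ} (hc : c ≠ 0) (u v : ℤ) :
    Summable fun n : ℤ => q ^ (c * tri n + u * n + v) := by
  have hq := hq0.ne'
  refine ((summable_theta (pow_pos hq0 c) (pow_lt_one₀ hq0.le hq1 hc)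
    (zpow_ne_zero u hq)).mul_right (q ^ v)).congr fun n => ?_
  rw [← zpow_natCast q c, ← zpow_mul, ← zpow_mul, zpow_add₀ hq, zpow_add₀ hq]

end TripleProduct

section Dissection

variable {q : ℝ}

lemma qProd_eq_prod (hq0 : 0 < q) (hq1 : q < 1) (a : ℕ) {d : ℕ} (hd : d ≠ 0) (k : ℕ) [NeZero k] :
    qProd q a d = ∏ r : Fin k, qProd q (d * r + a) (d * k) := by
  let e : Fin k × ℕ ≃ ℕ := (Equiv.prodComm _ _).trans (Nat.divModEquiv k).symm
  have he (x : Fin k × ℕ) : d * e x + a = d * k * x.2 + (d * x.1 + a) := by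
    change d * (x.2 * k + x.1) + a = _
    ring
  have hm : Multipliable fun x : Fin k × ℕ => 1 - q ^ (d * k * x.2 + (d * x.1 + a)) := by
    simpa only [Function.comp_def, he] using
      e.multipliable_iff.2 (multipliable_one_sub_pow hq0 hq1 a hd)
  have hf (r : Fin k) : Multipliable fun i : ℕ => 1 - q ^ (d * k * i + (d * r + a)) :=
    multipliable_one_sub_pow hq0 hq1 _ (mul_ne_zero hd (NeZero.ne k))
  rw [qProd, ← e.tprod_eq]
  simp only [he]
  rw [hm.tprod_prod' hf, tprod_fintype]
  rfl

lemma tsum_int_eq_sum {f : ℤ → ℝ} (hf : Summable f) (k : ℕ) [NeZero k] :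
    ∑' n, f n = ∑ r : Fin k, ∑' j : ℤ, f (j * k + r) := by
  let e : Fin k × ℤ ≃ ℤ := (Equiv.prodComm _ _).trans (Int.divModEquiv k).symm
  have hs := e.summable_iff.2 hf
  rw [← e.tsum_eq]
  exact (Summable.tsum_prod hs).trans (tsum_fintype _)

end Dissection

section QuintupleProduct

variable {q : ℝ}

lemma tsum_alternating_tri_eq_zero (q : ℝ) : ∑' n : ℤ, (-1) ^ n * q ^ (30 * tri n) = 0 := by
  have h := (Equiv.subLeft (1 : ℤ)).tsum_eq fun n => (-1) ^ n * q ^ (30 * tri n)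
  have h2 (n : ℤ) : (-1 : ℝ) ^ (1 - n) * q ^ (30 * tri (1 - n)) =
      -((-1) ^ n * q ^ (30 * tri n)) := by
    rw [tri_one_sub, zpow_sub₀ (by norm_num), zpow_one]
    rcases Int.even_or_odd n with hn | hn <;> simp [hn.neg_one_zpow]
  simp only [Equiv.subLeft_apply, h2, tsum_neg] at h
  linarith

/-- The instance of the quintuple product identity with base `q ^ 5` and parameter `q ^ 2`,
multiplied by `qProd q 10 10`, which the right-hand side expresses as the product of a theta
series in base `q ^ 30`. -/
theorem quintuple_product (hq0 : 0 < q) (hq1 : q < 1) :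
    (qProd q 5 5 * qProd q 2 5 * qProd q 3 5) * (qProd q 10 10 * qProd q 9 10 * qProd q 1 10) =
      (qProd q 30 30 * qProd q 20 30 * qProd q 10 30) *
        (∑' j : ℤ, q ^ (15 * tri j + 11 * j) - ∑' j : ℤ, q ^ (15 * tri j + 16 * j + 2)) := by
  have hq := hq0.ne'
  have h1 := hasSum_theta hq0 hq1 2 3 (by norm_num)
  have h2 := hasSum_theta hq0 hq1 9 1 (by norm_num)
  have h3 := (hasSum_theta hq0 hq1 20 10 (by norm_num)).tsum_eq
  have h4 := (hasSum_theta hq0 hq1 10 20 (by norm_num)).tsum_eq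
  norm_num at h1 h2 h3 h4
  let f : ℤ → ℤ → ℝ := fun m n =>
    ((-1) ^ m * q ^ (5 * tri m + 2 * m)) * ((-1) ^ n * q ^ (10 * tri n + 9 * n))
  let e : ℤ × ℤ ≃ ℤ × ℤ :=
    { toFun := fun x => (x.1 - 2 * x.2, x.2)
      invFun := fun x => (x.1 + 2 * x.2, x.2)
      left_inv := fun x => by ext <;> simp
      right_inv := fun x => by ext <;> simp }
  have hs := summable_mul_of_summable_norm h1.summable.norm h2.summable.norm
  have hs' : Summable fun x : ℤ × ℤ => f (x.1 - 2 * x.2) x.2 := e.summable_iff.2 hs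
  have hsum : ∑' N : ℤ, ∑' n : ℤ, f (N - 2 * n) n = _ :=
    (Summable.tsum_prod hs').symm.trans ((e.tsum_eq _).trans (h1.mul h2 hs).tsum_eq)
  have shift (r j : ℤ) : ∑' n : ℤ, f (j * 3 + r - 2 * n) n =
      ∑' p : ℤ, f (j + r - 2 * p) (j + p) := by
    rw [← (Equiv.addLeft j).tsum_eq]
    congr! 2 with p
    simp only [Equiv.coe_addLeft]
    congr 1
    ring
  have sign (r j p : ℤ) : (-1 : ℝ) ^ (j + r - 2 * p) * (-1) ^ (j + p) = (-1) ^ r * (-1) ^ p := by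
    rw [← zpow_add₀ (by norm_num), ← zpow_add₀ (by norm_num),
      show j + r - 2 * p + (j + p) = 2 * (j - p) + (r + p) by ring,
      zpow_add₀ (by norm_num), (even_two_mul _).neg_one_zpow, one_mul]
  have term (r j p E F : ℤ) (hE : 5 * tri (j + r - 2 * p) + 2 * (j + r - 2 * p) +
      (10 * tri (j + p) + 9 * (j + p)) = E + F) :
      f (j + r - 2 * p) (j + p) = ((-1) ^ r * q ^ E) * ((-1) ^ p * q ^ F) := by
    simp only [f]
    rw [mul_mul_mul_comm, sign, ← zpow_add₀ hq, hE, zpow_add₀ hq]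
    ring
  have r0 (j p : ℤ) := term 0 j p (15 * tri j + 11 * j) (30 * tri p + 20 * p) (by
    linarith [two_mul_tri (j + 0 - 2 * p), two_mul_tri (j + p), two_mul_tri j, two_mul_tri p])
  have r1 (j p : ℤ) := term 1 j p (15 * tri j + 16 * j + 2) (30 * tri p + 10 * p) (by
    linarith [two_mul_tri (j + 1 - 2 * p), two_mul_tri (j + p), two_mul_tri j, two_mul_tri p])
  have r2 (j p : ℤ) := term 2 j p (15 * tri j + 21 * j + 9) (30 * tri p) (by
    linarith [two_mul_tri (j + 2 - 2 * p), two_mul_tri (j + p), two_mul_tri j, two_mul_tri p])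
  rw [← hsum, tsum_int_eq_sum hs'.prod 3, Fin.sum_univ_three]
  simp only [Fin.val_zero, Fin.val_one, Fin.val_two, Nat.cast_ofNat, Nat.cast_zero, Nat.cast_one,
    shift, r0, r1, r2, tsum_mul_left, tsum_mul_right, h3, h4, tsum_alternating_tri_eq_zero]
  norm_num
  ring

end QuintupleProduct

section ProductIdentity

variable {q : ℝ}

lemma qProd_identity (hq0 : 0 < q) (hq1 : q < 1) :
    qProd q 1 1 * (qProd q 10 10 * qProd q 8 10 * qProd q 2 10) *
        (qProd q 30 30 * qProd q 20 30 * qProd q 10 30) =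
      qProd q 2 2 * ((qProd q 5 5 * qProd q 2 5 * qProd q 3 5) *
        (qProd q 10 10 * qProd q 9 10 * qProd q 1 10)) := by
  have h1 := qProd_eq_prod hq0 hq1 1 one_ne_zero 10
  have h2 := qProd_eq_prod hq0 hq1 2 two_ne_zero 5
  have h3 := qProd_eq_prod hq0 hq1 10 (d := 10) (by norm_num) 3
  have h4 (a : ℕ) := qProd_eq_prod hq0 hq1 a (d := 5) (by norm_num) 2
  simp [Fin.prod_univ_succ] at h1 h2 h3 h4
  have h5 : qProd q 30 30 * qProd q 20 30 * qProd q 10 30 = qProd q 10 10 := by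
    rw [h3]
    ring
  rw [h1, h2, h4 5, h4 2, h4 3, h5]
  ring

end ProductIdentity

section Characters

variable {q : ℝ}

lemma eulerProd_eq_qProd (q : ℝ) : eulerProd q = qProd q 1 1 := by
  simp only [eulerProd, qProd, one_mul]

lemma eulerProd_sq_eq_qProd (q : ℝ) : eulerProd (q ^ 2) = qProd q 2 2 := by
  unfold eulerProd qProd
  congr! 2 with i
  rw [← pow_mul]
  ring

lemma summable_zpow_quadratic (hq0 : 0 < q) (hq1 : q < 1) {c : ℕ} (hc : c ≠ 0) (u v : ℤ) :
    Summable fun k : ℤ => q ^ (c * k ^ 2 + u * k + v) := by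
  refine (summable_zpow_tri hq0 hq1 (c := 2 * c) (by lia) (u + c) v).congr fun k => ?_
  congr 1
  push_cast
  linear_combination (c : ℤ) * two_mul_tri k

lemma tsum_theta_difference (hq0 : 0 < q) (hq1 : q < 1) :
    ∑' j : ℤ, q ^ (15 * tri j + 11 * j) - ∑' j : ℤ, q ^ (15 * tri j + 16 * j + 2) =
      ∑' k : ℤ, (q ^ (30 * k ^ 2 + k * 7) - q ^ (30 * k ^ 2 + 17 * k + 2)) -
        q * ∑' k : ℤ, (q ^ (30 * k ^ 2 + k * (-13)) - q ^ (30 * k ^ 2 + 37 * k + 10)) := by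
  have hq := hq0.ne'
  have hs0 : Summable fun j : ℤ => q ^ (15 * tri j + 11 * j) := by
    simpa using summable_zpow_tri hq0 hq1 (c := 15) (by norm_num) 11 0
  have hs1 : Summable fun j : ℤ => q ^ (15 * tri j + 16 * j + 2) := by
    simpa using summable_zpow_tri hq0 hq1 (c := 15) (by norm_num) 16 2
  have s (u v : ℤ) : Summable fun k : ℤ => q ^ (30 * k ^ 2 + u * k + v) :=
    summable_zpow_quadratic hq0 hq1 (c := 30) (by norm_num) u v
  have a0 (k : ℤ) : 15 * tri (k * 2) + 11 * (k * 2) = 30 * k ^ 2 + 7 * k + 0 := by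
    linarith [two_mul_tri (k * 2)]
  have a1 (k : ℤ) : 15 * tri (k * 2 + 1) + 11 * (k * 2 + 1) = 1 + (30 * k ^ 2 + 37 * k + 10) := by
    linarith [two_mul_tri (k * 2 + 1)]
  have b0 (k : ℤ) : 15 * tri (k * 2) + 16 * (k * 2) + 2 = 30 * k ^ 2 + 17 * k + 2 := by
    linarith [two_mul_tri (k * 2)]
  have b1 (k : ℤ) : 15 * tri ((k - 1) * 2 + 1) + 16 * ((k - 1) * 2 + 1) + 2 =
      1 + (30 * k ^ 2 + -13 * k + 0) := by
    linarith [two_mul_tri ((k - 1) * 2 + 1)]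
  have e (k : ℤ) : 30 * k ^ 2 + k * 7 = 30 * k ^ 2 + 7 * k + 0 := by ring
  have e' (k : ℤ) : 30 * k ^ 2 + k * (-13) = 30 * k ^ 2 + -13 * k + 0 := by ring
  rw [tsum_int_eq_sum hs0 2, tsum_int_eq_sum hs1 2, Fin.sum_univ_two, Fin.sum_univ_two]
  simp only [Fin.val_zero, Fin.val_one, Nat.cast_ofNat, Nat.cast_zero, Nat.cast_one]
  rw [← (Equiv.subRight (1 : ℤ)).tsum_eq fun j : ℤ =>
    q ^ (15 * tri (j * 2 + 1) + 16 * (j * 2 + 1) + 2)]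
  simp only [Equiv.subRight_apply, b1, e, e']
  rw [(s 7 0).tsum_sub (s 17 2), (s (-13) 0).tsum_sub (s 37 10)]
  simp only [add_zero (_ * 2 : ℤ), a0, a1, b0, zpow_one_add₀ hq, tsum_mul_left]
  ring

lemma tsum_theta_two_five (hq0 : 0 < q) (hq1 : q < 1) :
    ∑' k : ℤ, ((q ^ 2) ^ (10 * k ^ 2 + k * 3) - (q ^ 2) ^ (10 * k ^ 2 + 7 * k + 1)) =
      qProd q 10 10 * qProd q 8 10 * qProd q 2 10 := by
  have h := hasSum_theta hq0 hq1 8 2 (by norm_num)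
  norm_num at h
  have s (u v : ℤ) : Summable fun k : ℤ => q ^ (20 * k ^ 2 + u * k + v) :=
    summable_zpow_quadratic hq0 hq1 (c := 20) (by norm_num) u v
  have a0 (k : ℤ) : 10 * tri (k * 2) + 8 * (k * 2) = 20 * k ^ 2 + 6 * k + 0 := by
    linarith [two_mul_tri (k * 2)]
  have a1 (k : ℤ) : 10 * tri ((-1 - k) * 2 + 1) + 8 * ((-1 - k) * 2 + 1) =
      20 * k ^ 2 + 14 * k + 2 := by
    linarith [two_mul_tri ((-1 - k) * 2 + 1)]
  have e0 (k : ℤ) : (q ^ 2) ^ (10 * k ^ 2 + k * 3) = q ^ (20 * k ^ 2 + 6 * k + 0) := by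
    rw [← zpow_natCast, ← zpow_mul]
    congr 1
    push_cast
    ring
  have e1 (k : ℤ) : (q ^ 2) ^ (10 * k ^ 2 + 7 * k + 1) = q ^ (20 * k ^ 2 + 14 * k + 2) := by
    rw [← zpow_natCast, ← zpow_mul]
    congr 1
    push_cast
    ring
  have o (k : ℤ) : (-1 : ℝ) ^ (k * 2 + 1) = -1 :=
    Odd.neg_one_zpow ⟨k, by ring⟩
  have o' (k : ℤ) : (-1 : ℝ) ^ (k * 2) = 1 :=
    Even.neg_one_zpow ⟨k, by ring⟩
  rw [← h.tsum_eq, tsum_int_eq_sum h.summable 2, Fin.sum_univ_two]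
  simp only [Fin.val_zero, Fin.val_one, Nat.cast_ofNat, Nat.cast_zero, Nat.cast_one]
  rw [← (Equiv.subLeft (-1 : ℤ)).tsum_eq fun j : ℤ =>
    (-1) ^ (j * 2 + 1) * q ^ (10 * tri (j * 2 + 1) + 8 * (j * 2 + 1))]
  simp only [Equiv.subLeft_apply, a1, e0, e1, o]
  rw [(s 6 0).tsum_sub (s 14 2)]
  simp only [add_zero (_ * 2 : ℤ), a0, o', one_mul, tsum_mul_left]
  ring

end Characters

end QSeries

open QSeries in
theorem chi_5_6_diff_eq_chi_2_5_1_1_sq (q : ℝ) (hq0 : 0 < q) (hq1 : q < 1) :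
    minChar 5 6 2 1 q - minChar 5 6 2 5 q = minChar 2 5 1 1 (q ^ 2) := by
  have h0 : qProd q 30 30 * qProd q 20 30 * qProd q 10 30 ≠ 0 :=
    mul_ne_zero (mul_ne_zero (qProd_ne_zero hq0 hq1 (by norm_num) (by norm_num))
      (qProd_ne_zero hq0 hq1 (by norm_num) (by norm_num)))
      (qProd_ne_zero hq0 hq1 (by norm_num) (by norm_num))
  have h1 := qProd_ne_zero hq0 hq1 one_ne_zero one_ne_zero
  have h2 := qProd_ne_zero hq0 hq1 two_ne_zero two_ne_zero
  have key := qProd_identity hq0 hq1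
  rw [quintuple_product hq0 hq1, mul_left_comm (qProd q 2 2), mul_comm (qProd q 1 1 * _),
    mul_right_inj' h0, tsum_theta_difference hq0 hq1, ← tsum_theta_two_five hq0 hq1] at key
  have p1 : q ^ (41 / 30 : ℝ) = q ^ (11 / 30 : ℝ) * q := by
    rw [← Real.rpow_add_one hq0.ne']
    norm_num
  have p2 : (q ^ 2) ^ (11 / 60 : ℝ) = q ^ (11 / 30 : ℝ) := by
    rw [← Real.rpow_natCast, ← Real.rpow_mul hq0.le]
    norm_num
  unfold minChar
  rw [eulerProd_sq_eq_qProd, eulerProd_eq_qProd]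
  norm_num
  norm_num at key
  rw [p1, p2]
  field_simp
  linear_combination -key
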